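/- Let α ≥ 0 and let f : (0,∞) → (0,∞) be such that x^α f(x) = ∫₀^∞ e^{-xt} u(t) dt for all x > 0, where u : (0,∞) → (0,∞) is decreasing, logarithmically convex, and integrable on (0,1). Then: (a) x ↦ x^{α+1} f(x) belongs to the generalized Bernstein class B_1, i.e. its derivative is completely monotonic; (b) x ↦ 1/f(x) belongs to B_{α+1}, i.e. x ↦ x^{-α} (1/f)'(x) is completely monotonic; (c) x ↦ 1/(x^{α+1} f(x)) is completely monotonic on (0,∞). -/

import Mathlib

open MeasureTheory Real Set

/-- `f` is completely monotonic on `(0,∞)`. -/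
def CompletelyMonotonicOn (f : ℝ → ℝ) : Prop :=
  ContDiffOn ℝ (⊤ : ℕ∞) f (Set.Ioi 0) ∧
  ∀ (n : ℕ) (x : ℝ), 0 < x → 0 ≤ (-1 : ℝ) ^ n * iteratedDeriv n f x

namespace CompletelyMonotonicOn

theorem congr {f g : ℝ → ℝ} (hf : CompletelyMonotonicOn f) (h : EqOn g f (Ioi 0)) :
    CompletelyMonotonicOn g :=
  ⟨hf.1.congr h, fun n x hx => by
    rw [h.iteratedDeriv_of_isOpen isOpen_Ioi n hx]; exact hf.2 n x hx⟩

theorem add {f g : ℝ → ℝ} (hf : CompletelyMonotonicOn f) (hg : CompletelyMonotonicOn g) :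
    CompletelyMonotonicOn (f + g) := by
  refine ⟨hf.1.add hg.1, fun n x hx => ?_⟩
  have hmem : Ioi (0 : ℝ) ∈ nhds x := Ioi_mem_nhds hx
  have hn : ((n : ℕ∞) : WithTop ℕ∞) ≤ ((⊤ : ℕ∞) : WithTop ℕ∞) := by exact_mod_cast le_top
  rw [iteratedDeriv_add ((hf.1.contDiffAt hmem).of_le hn) ((hg.1.contDiffAt hmem).of_le hn),
    mul_add]
  exact add_nonneg (hf.2 n x hx) (hg.2 n x hx)

theorem const_mul {f : ℝ → ℝ} (hf : CompletelyMonotonicOn f) {c : ℝ} (hc : 0 ≤ c) :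
    CompletelyMonotonicOn (fun x => c * f x) := by
  refine ⟨contDiffOn_const.mul hf.1, fun n x hx => ?_⟩
  rw [iteratedDeriv_const_mul_field, mul_left_comm]
  exact mul_nonneg hc (hf.2 n x hx)

end CompletelyMonotonicOn

section DerivativeSequence

variable {F : ℕ → ℝ → ℝ}

theorem contDiffOn_of_hasDerivAt_neg_succ
    (hF : ∀ n, ∀ x : ℝ, 0 < x → HasDerivAt (F n) (-(F (n + 1) x)) x) (n : ℕ) :
    ContDiffOn ℝ (⊤ : ℕ∞) (F n) (Ioi 0) := by
  rw [contDiffOn_infty]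
  intro k
  induction k generalizing n with
  | zero =>
    rw [Nat.cast_zero, contDiffOn_zero]
    exact fun x hx => (hF n x hx).continuousAt.continuousWithinAt
  | succ k ih =>
    rw [Nat.cast_succ, contDiffOn_succ_iff_deriv_of_isOpen isOpen_Ioi]
    exact ⟨fun x hx => (hF n x hx).differentiableAt.differentiableWithinAt, by simp,
      (ih (n + 1)).neg.congr fun x hx => (hF n x hx).deriv⟩

theorem iteratedDeriv_of_hasDerivAt_neg_succ
    (hF : ∀ n, ∀ x : ℝ, 0 < x → HasDerivAt (F n) (-(F (n + 1) x)) x) (n : ℕ) {x : ℝ}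
    (hx : 0 < x) : iteratedDeriv n (F 0) x = (-1) ^ n * F n x := by
  induction n generalizing x with
  | zero => simp
  | succ n ih =>
    have h : iteratedDeriv n (F 0) =ᶠ[nhds x] fun y => (-1) ^ n * F n y := by
      filter_upwards [Ioi_mem_nhds hx] with y hy using ih hy
    rw [iteratedDeriv_succ, h.deriv_eq, ((hF n x hx).const_mul _).deriv]
    ring

theorem completelyMonotonicOn_of_hasDerivAt_neg_succ
    (hF : ∀ n, ∀ x : ℝ, 0 < x → HasDerivAt (F n) (-(F (n + 1) x)) x)
    (hpos : ∀ n, ∀ x : ℝ, 0 < x → 0 ≤ F n x) : CompletelyMonotonicOn (F 0) := by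
  refine ⟨contDiffOn_of_hasDerivAt_neg_succ hF 0, fun n x hx => ?_⟩
  rw [iteratedDeriv_of_hasDerivAt_neg_succ hF n hx, ← mul_assoc, ← mul_pow]
  simpa using hpos n x hx

end DerivativeSequence

section Reciprocal

variable {h : ℝ → ℝ}

/-- Normalised Taylor coefficients, with alternating signs, of `h` at `x`. -/
noncomputable def alternatingTaylorCoeff (h : ℝ → ℝ) (x : ℝ) (n : ℕ) : ℝ :=
  (-1) ^ n * iteratedDeriv n h x / n.factorial

theorem sum_alternatingTaylorCoeff_mul_inv (hsm : ContDiffOn ℝ (⊤ : ℕ∞) h (Ioi 0))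
    (hpos : ∀ x : ℝ, 0 < x → 0 < h x) {x : ℝ} (hx : 0 < x) (n : ℕ) :
    ∑ k ∈ Finset.range (n + 2), alternatingTaylorCoeff h x k *
      alternatingTaylorCoeff (fun y => 1 / h y) x (n + 1 - k) = 0 := by
  have hmem : Ioi (0 : ℝ) ∈ nhds x := Ioi_mem_nhds hx
  have hn : (((n + 1 : ℕ) : ℕ∞) : WithTop ℕ∞) ≤ ((⊤ : ℕ∞) : WithTop ℕ∞) := by
    exact_mod_cast le_top
  have hinv : ContDiffOn ℝ (⊤ : ℕ∞) (fun y => 1 / h y) (Ioi 0) :=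
    contDiffOn_const.div hsm fun y hy => (hpos y hy).ne'
  have hone : iteratedDeriv (n + 1) (h * fun y => 1 / h y) x = 0 := by
    have : (h * fun y => 1 / h y) =ᶠ[nhds x] fun _ => (1 : ℝ) := by
      filter_upwards [hmem] with y hy
      simp [mul_inv_cancel₀ (hpos y hy).ne']
    rw [this.iteratedDeriv_eq]
    simp [iteratedDeriv_const]
  rw [iteratedDeriv_mul ((hsm.contDiffAt hmem).of_le hn) ((hinv.contDiffAt hmem).of_le hn)] at hone
  rw [← mul_zero ((-1 : ℝ) ^ (n + 1) / (n + 1).factorial), ← hone, Finset.mul_sum]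
  refine Finset.sum_congr rfl fun k hk => ?_
  have hk' : k ≤ n + 1 := by simpa [Nat.lt_succ_iff] using hk
  have hfac : ((n + 1).choose k : ℝ) * k.factorial * (n + 1 - k).factorial
      = (n + 1).factorial := by exact_mod_cast Nat.choose_mul_factorial_mul_factorial hk'
  have hsign : (-1 : ℝ) ^ (n + 1) = (-1) ^ k * (-1) ^ (n + 1 - k) := by
    rw [← pow_add, Nat.add_sub_cancel' hk']
  have hne : ((n + 1).choose k : ℝ) ≠ 0 := by exact_mod_cast (Nat.choose_pos hk').ne'
  rw [alternatingTaylorCoeff, alternatingTaylorCoeff, hsign, ← hfac]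
  field_simp

/-- The reciprocal of a positive function with completely monotonic derivative is completely
monotonic. -/
theorem CompletelyMonotonicOn.one_div_of_deriv (hsm : ContDiffOn ℝ (⊤ : ℕ∞) h (Ioi 0))
    (hpos : ∀ x : ℝ, 0 < x → 0 < h x) (hd : CompletelyMonotonicOn (deriv h)) :
    CompletelyMonotonicOn (fun x => 1 / h x) := by
  refine ⟨contDiffOn_const.div hsm fun y hy => (hpos y hy).ne', fun n x hx => ?_⟩
  suffices H : 0 ≤ alternatingTaylorCoeff (fun y => 1 / h y) x n by
    have := mul_nonneg H (Nat.cast_nonneg (α := ℝ) n.factorial)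
    rwa [alternatingTaylorCoeff, div_mul_cancel₀ _ (by positivity)] at this
  induction n using Nat.strong_induction_on with
  | _ n ih =>
    rcases n with _ | n
    · simpa [alternatingTaylorCoeff] using (hpos x hx).le
    have hsum := sum_alternatingTaylorCoeff_mul_inv hsm hpos hx n
    rw [Finset.sum_range_succ'] at hsum
    have h0 : alternatingTaylorCoeff h x 0 = h x := by simp [alternatingTaylorCoeff]
    have hle : ∑ k ∈ Finset.range (n + 1), alternatingTaylorCoeff h x (k + 1) *
        alternatingTaylorCoeff (fun y => 1 / h y) x (n + 1 - (k + 1)) ≤ 0 := by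
      refine Finset.sum_nonpos fun k _ => mul_nonpos_of_nonpos_of_nonneg ?_ (ih _ (by omega))
      have := hd.2 k x hx
      rw [alternatingTaylorCoeff, iteratedDeriv_succ', pow_succ]
      exact div_nonpos_of_nonpos_of_nonneg (by linarith) (by positivity)
    rw [h0, Nat.sub_zero] at hsum
    exact nonneg_of_mul_nonneg_right (by linarith) (hpos x hx)

/-- Kaluza's theorem: the reciprocal of a power series with positive log-convex coefficients has
nonpositive coefficients beyond the constant one. -/
theorem nonpos_of_logConvex_of_sum_mul_eq_zero {a c : ℕ → ℝ} (ha : ∀ n, 0 < a n)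
    (hlog : ∀ n, a (n + 1) ^ 2 ≤ a n * a (n + 2))
    (hc : 0 < c 0)
    (hsum : ∀ n, ∑ k ∈ Finset.range (n + 2), a k * c (n + 1 - k) = 0) (n : ℕ) :
    c (n + 1) ≤ 0 := by
  have hmono : Monotone fun k => a (k + 1) / a k := by
    refine monotone_nat_of_le_succ fun k => ?_
    rw [div_le_div_iff₀ (ha k) (ha (k + 1))]
    nlinarith [hlog k]
  induction n using Nat.strong_induction_on with
  | _ n ih =>
    have hs := hsum n
    rw [Finset.sum_range_succ', Nat.sub_zero] at hs
    suffices H : 0 ≤ ∑ k ∈ Finset.range (n + 1), a (k + 1) * c (n + 1 - (k + 1)) by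
      have : a 0 * c (n + 1) ≤ 0 := by linarith
      exact nonpos_of_mul_nonpos_right this (ha 0)
    rcases n with _ | n
    · simpa using mul_nonneg (ha 1).le hc.le
    have key : ∑ k ∈ Finset.range (n + 2), a (k + 1) * c (n + 1 - k)
        = ∑ k ∈ Finset.range (n + 2),
          (a (k + 1) / a k - a (n + 2) / a (n + 1)) * (a k * c (n + 1 - k)) := by
      simp_rw [sub_mul]
      rw [Finset.sum_sub_distrib, ← Finset.mul_sum, hsum n, mul_zero, sub_zero]
      refine Finset.sum_congr rfl fun k _ => ?_
      have := (ha k).ne'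
      field_simp
    simp_rw [Nat.add_sub_add_right]
    rw [key]
    refine Finset.sum_nonneg fun k hk => ?_
    rw [Finset.mem_range] at hk
    obtain rfl | hlt := eq_or_ne k (n + 1)
    · simp
    have h1 : a (k + 1) / a k ≤ a (n + 2) / a (n + 1) := hmono (show k ≤ n + 1 by omega)
    have h2 : c (n + 1 - k) ≤ 0 := by
      obtain ⟨j, hj⟩ : ∃ j, n + 1 - k = j + 1 := ⟨n - k, by omega⟩
      rw [hj]
      exact ih j (by omega)
    exact mul_nonneg_of_nonpos_of_nonpos (by linarith)
      (mul_nonpos_of_nonneg_of_nonpos (ha k).le h2)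

theorem completelyMonotonicOn_deriv_one_div (hsm : ContDiffOn ℝ (⊤ : ℕ∞) h (Ioi 0))
    (hpos : ∀ n, ∀ x : ℝ, 0 < x → 0 < alternatingTaylorCoeff h x n)
    (hlog : ∀ n, ∀ x : ℝ, 0 < x → alternatingTaylorCoeff h x (n + 1) ^ 2 ≤
      alternatingTaylorCoeff h x n * alternatingTaylorCoeff h x (n + 2)) :
    CompletelyMonotonicOn (deriv fun x => 1 / h x) := by
  have hh : ∀ x : ℝ, 0 < x → 0 < h x := fun x hx => by
    simpa [alternatingTaylorCoeff] using hpos 0 x hx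
  have hinv : ContDiffOn ℝ (⊤ : ℕ∞) (fun y => 1 / h y) (Ioi 0) :=
    contDiffOn_const.div hsm fun y hy => (hh y hy).ne'
  refine ⟨((contDiffOn_infty_iff_deriv_of_isOpen isOpen_Ioi).1 hinv).2, fun n x hx => ?_⟩
  have hk := nonpos_of_logConvex_of_sum_mul_eq_zero (fun n => hpos n x hx) (fun n => hlog n x hx)
    (by simpa [alternatingTaylorCoeff] using hh x hx)
    (sum_alternatingTaylorCoeff_mul_inv hsm hh hx) n
  have hk' := mul_nonpos_of_nonpos_of_nonneg hk (Nat.cast_nonneg (α := ℝ) (n + 1).factorial)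
  rw [alternatingTaylorCoeff, div_mul_cancel₀ _ (by positivity), iteratedDeriv_succ',
    pow_succ] at hk'
  linarith

end Reciprocal

section Moments

theorem integrableOn_pow_mul_exp_neg_mul (n : ℕ) {c : ℝ} (hc : 0 < c) :
    IntegrableOn (fun t : ℝ => t ^ n * exp (-c * t)) (Ioi 0) := by
  have hn : (-1 : ℝ) < n := by linarith [Nat.cast_nonneg (α := ℝ) n]
  simpa using integrableOn_rpow_mul_exp_neg_mul_rpow hn one_pos hc

theorem integral_pow_mul_exp_neg_mul (n : ℕ) {c : ℝ} (hc : 0 < c) :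
    ∫ t in Ioi (0 : ℝ), t ^ n * exp (-c * t) = n.factorial / c ^ (n + 1) := by
  have h := integral_rpow_mul_exp_neg_mul_Ioi (a := n + 1) (by positivity) hc
  rw [Gamma_nat_eq_factorial] at h
  simp only [add_sub_cancel_right, rpow_natCast, ← neg_mul] at h
  rw [h, show ((n : ℝ) + 1) = ((n + 1 : ℕ) : ℝ) by push_cast; ring, rpow_natCast, one_div, inv_pow,
    inv_mul_eq_div]

theorem setIntegral_Ioi_zero_pos {g : ℝ → ℝ} (hint : IntegrableOn g (Ioi 0))
    (hnonneg : ∀ t : ℝ, 0 < t → 0 ≤ g t) {s : ℝ} (hpos : ∀ t : ℝ, 0 < t → s < t → 0 < g t) :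
    0 < ∫ t in Ioi (0 : ℝ), g t := by
  rw [setIntegral_pos_iff_support_of_nonneg_ae
    ((ae_restrict_mem measurableSet_Ioi).mono fun t ht => hnonneg t ht) hint]
  refine lt_of_lt_of_le ?_ (measure_mono (s := Ioi (max 0 s)) fun t ht => ?_)
  · simp
  · have ht' := max_lt_iff.1 (mem_Ioi.1 ht)
    exact ⟨(hpos t ht'.1 ht'.2).ne', ht'.1⟩

/-- If `D` is negative exactly on an interval and its moments of orders `n` and `n + 1` vanish,
then its moment of order `n + 2` is nonnegative. -/
theorem moment_nonneg_of_ordConnected {D : ℝ → ℝ} {n : ℕ}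
    (hD : OrdConnected {t | t ∈ Ioi (0 : ℝ) ∧ D t < 0})
    (hint : ∀ k, IntegrableOn (fun t => t ^ k * D t) (Ioi 0))
    (h0 : ∫ t in Ioi (0 : ℝ), t ^ n * D t = 0)
    (h1 : ∫ t in Ioi (0 : ℝ), t ^ (n + 1) * D t = 0) :
    0 ≤ ∫ t in Ioi (0 : ℝ), t ^ (n + 2) * D t := by
  set I := {t | t ∈ Ioi (0 : ℝ) ∧ D t < 0} with hI
  have hout : ∀ t : ℝ, 0 < t → t ∉ I → 0 ≤ D t := fun t ht hn =>
    not_lt.1 fun hlt => hn ⟨ht, hlt⟩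
  rcases I.eq_empty_or_nonempty with hemp | hne
  · refine setIntegral_nonneg measurableSet_Ioi fun t ht => ?_
    exact mul_nonneg (pow_nonneg (le_of_lt ht) _) (hout t ht (by simp [hemp]))
  have hbelow : BddBelow I := ⟨0, fun t ht => le_of_lt ht.1⟩
  have hleft : ∀ t : ℝ, 0 < t → t < sInf I → 0 ≤ D t := fun t ht hlt =>
    hout t ht (notMem_of_lt_csInf hlt hbelow)
  by_cases habove : BddAbove I
  · have hpoly : ∫ t in Ioi (0 : ℝ), t ^ n * D t * ((t - sInf I) * (t - sSup I))
        = ∫ t in Ioi (0 : ℝ), t ^ (n + 2) * D t := by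
      have heq : ∀ t : ℝ, t ^ n * D t * ((t - sInf I) * (t - sSup I))
          = t ^ (n + 2) * D t - (sInf I + sSup I) * (t ^ (n + 1) * D t)
            + (sInf I * sSup I) * (t ^ n * D t) := fun t => by ring
      simp_rw [heq]
      have hsub : IntegrableOn
          (fun t => t ^ (n + 2) * D t - (sInf I + sSup I) * (t ^ (n + 1) * D t)) (Ioi 0) :=
        (hint _).sub ((hint _).const_mul _)
      rw [integral_add hsub ((hint _).const_mul _),
        integral_sub (hint _) ((hint _).const_mul _), integral_const_mul, integral_const_mul,
        h0, h1]
      ring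
    rw [← hpoly]
    refine setIntegral_nonneg measurableSet_Ioi fun t ht => ?_
    have htn : 0 ≤ t ^ n := pow_nonneg (le_of_lt ht) _
    rcases lt_or_ge t (sInf I) with h | h
    · have hle : t ≤ sSup I := h.le.trans (csInf_le_csSup hne hbelow habove)
      exact mul_nonneg (mul_nonneg htn (hleft t ht h))
        (mul_nonneg_of_nonpos_of_nonpos (by linarith) (by linarith))
    rcases lt_or_ge (sSup I) t with h' | h'
    · exact mul_nonneg (mul_nonneg htn (hout t ht (notMem_of_csSup_lt h' habove)))
        (mul_nonneg (by linarith) (by linarith))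
    rcases h.eq_or_lt with h | h
    · simp [h]
    rcases h'.eq_or_lt with h' | h'
    · simp [h']
    obtain ⟨r, hr, hrt⟩ := exists_lt_of_csInf_lt hne h
    obtain ⟨s, hs, hts⟩ := exists_lt_of_lt_csSup hne h'
    have htI : t ∈ I := hD.out hr hs ⟨hrt.le, hts.le⟩
    exact mul_nonneg_of_nonpos_of_nonpos (mul_nonpos_of_nonneg_of_nonpos htn htI.2.le)
      (mul_nonpos_of_nonneg_of_nonpos (by linarith) (by linarith))
  · exfalso
    have hright : ∀ t : ℝ, sInf I < t → t ∈ I := fun t h => by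
      obtain ⟨r, hr, hrt⟩ := exists_lt_of_csInf_lt hne h
      obtain ⟨s, hs, hts⟩ := not_bddAbove_iff.1 habove t
      exact hD.out hr hs ⟨hrt.le, hts.le⟩
    have heq : ∀ t : ℝ, t ^ n * D t * (sInf I - t)
        = sInf I * (t ^ n * D t) - t ^ (n + 1) * D t := fun t => by ring
    have hzero : ∫ t in Ioi (0 : ℝ), t ^ n * D t * (sInf I - t) = 0 := by
      simp_rw [heq]
      rw [integral_sub ((hint _).const_mul _) (hint _), integral_const_mul, h0, h1]
      ring
    have hgt : ∀ t : ℝ, 0 < t → sInf I < t → 0 < t ^ n * D t * (sInf I - t) := fun t ht h =>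
      mul_pos_of_neg_of_neg (mul_neg_of_pos_of_neg (pow_pos ht _) (hright t h).2) (by linarith)
    refine (setIntegral_Ioi_zero_pos (s := sInf I) ?_ (fun t ht => ?_) hgt).ne' hzero
    · simp_rw [heq]
      exact ((hint _).const_mul _).sub (hint _)
    · rcases lt_trichotomy t (sInf I) with h | h | h
      · exact mul_nonneg (mul_nonneg (pow_nonneg ht.le _) (hleft t ht h)) (by linarith)
      · simp [← h]
      · exact (hgt t ht h).le

/-- The normalised moments of a log-convex function on `(0,∞)` form a log-convex sequence. -/
theorem sq_moment_le_of_logConvex {v : ℝ → ℝ} (hpos : ∀ t : ℝ, 0 < t → 0 < v t)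
    (hconv : ConvexOn ℝ (Ioi 0) fun t => log (v t))
    (hint : ∀ k, IntegrableOn (fun t => t ^ k * v t) (Ioi 0)) (n : ℕ) :
    (n + 2) * (∫ t in Ioi (0 : ℝ), t ^ (n + 1) * v t) ^ 2 ≤
      (n + 1) * (∫ t in Ioi (0 : ℝ), t ^ n * v t) * ∫ t in Ioi (0 : ℝ), t ^ (n + 2) * v t := by
  have hm : ∀ k, 0 < ∫ t in Ioi (0 : ℝ), t ^ k * v t := fun k =>
    setIntegral_Ioi_zero_pos (hint k) (fun t ht => (mul_pos (pow_pos ht k) (hpos t ht)).le)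
      (s := 0) fun t ht _ => mul_pos (pow_pos ht k) (hpos t ht)
  have ha := hm n
  have hb := hm (n + 1)
  set a := ∫ t in Ioi (0 : ℝ), t ^ n * v t with ha_def
  set b := ∫ t in Ioi (0 : ℝ), t ^ (n + 1) * v t with hb_def
  obtain ⟨c, hc_def⟩ : ∃ c, c = (n + 1) * a / b := ⟨_, rfl⟩
  have hc : 0 < c := by rw [hc_def]; positivity
  obtain ⟨A, hA_def⟩ : ∃ A, A = a * c ^ (n + 1) / n.factorial := ⟨_, rfl⟩
  have hA : 0 < A := by rw [hA_def]; positivity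
  have hb_eq : b = (n + 1) * a / c := by rw [hc_def]; field_simp
  have hcomp : ∀ t : ℝ, ∀ k : ℕ, t ^ k * (v t - A * exp (-c * t))
      = t ^ k * v t - A * (t ^ k * exp (-c * t)) := fun t k => by ring
  have hDint : ∀ k, IntegrableOn (fun t => t ^ k * (v t - A * exp (-c * t))) (Ioi 0) := fun k => by
    simp_rw [hcomp]
    exact (hint k).sub ((integrableOn_pow_mul_exp_neg_mul k hc).const_mul A)
  have hDmom : ∀ k, ∫ t in Ioi (0 : ℝ), t ^ k * (v t - A * exp (-c * t))
      = (∫ t in Ioi (0 : ℝ), t ^ k * v t) - A * (k.factorial / c ^ (k + 1)) := fun k => by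
    simp_rw [hcomp]
    rw [integral_sub (hint k) ((integrableOn_pow_mul_exp_neg_mul k hc).const_mul A),
      integral_const_mul, integral_pow_mul_exp_neg_mul k hc]
  have hfac : (n.factorial : ℝ) ≠ 0 := by positivity
  have hord : OrdConnected {t | t ∈ Ioi (0 : ℝ) ∧ v t - A * exp (-c * t) < 0} := by
    have hψ : ConvexOn ℝ (Ioi 0) fun t => log (v t) + c * t :=
      hconv.add ((LinearMap.mul ℝ ℝ c).convexOn (convex_Ioi 0))
    have hset : {t | t ∈ Ioi (0 : ℝ) ∧ v t - A * exp (-c * t) < 0}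
        = {t | t ∈ Ioi (0 : ℝ) ∧ log (v t) + c * t < log A} := by
      ext t
      refine and_congr_right fun ht => ?_
      rw [sub_neg, ← log_lt_log_iff (hpos t ht) (by positivity), log_mul hA.ne' (exp_ne_zero _),
        log_exp]
      constructor <;> intro h <;> linarith
    rw [hset]
    exact (hψ.convex_lt (log A)).ordConnected
  have key := moment_nonneg_of_ordConnected (n := n) hord hDint
    (by rw [hDmom, ← ha_def, hA_def]; field_simp; ring)
    (by rw [hDmom, ← hb_def, hb_eq, hA_def, Nat.factorial_succ]; push_cast; field_simp; ring)
  rw [hDmom, sub_nonneg] at key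
  have hlast : A * ((n + 2).factorial / c ^ (n + 2 + 1)) = (n + 2) * b ^ 2 / ((n + 1) * a) := by
    rw [hb_eq, hA_def, Nat.factorial_succ, Nat.factorial_succ]
    push_cast
    field_simp
    ring
  rw [hlast, div_le_iff₀ (by positivity)] at key
  linarith

end Moments

section Laplace

/-- `∫₀^∞ tⁿ e^{-xt} u(t) dt`. -/
noncomputable def laplaceMoment (u : ℝ → ℝ) (n : ℕ) (x : ℝ) : ℝ :=
  ∫ t in Ioi (0 : ℝ), t ^ n * (exp (-x * t) * u t)

variable {u : ℝ → ℝ}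

theorem integrableOn_laplaceMoment (hupos : ∀ t : ℝ, 0 < t → 0 < u t)
    (hudec : AntitoneOn u (Ioi 0)) (huint : IntegrableOn u (Ioo 0 1)) (n : ℕ) {x : ℝ}
    (hx : 0 < x) : IntegrableOn (fun t => t ^ n * (exp (-x * t) * u t)) (Ioi 0) := by
  have hu : AEStronglyMeasurable u (volume.restrict (Ioi 0)) :=
    (aemeasurable_restrict_of_antitoneOn measurableSet_Ioi hudec).aestronglyMeasurable
  have hmeas : AEStronglyMeasurable (fun t => t ^ n * (exp (-x * t) * u t))
      (volume.restrict (Ioi 0)) :=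
    (by fun_prop : Continuous fun t : ℝ => t ^ n).aestronglyMeasurable.mul
      ((by fun_prop : Continuous fun t : ℝ => exp (-x * t)).aestronglyMeasurable.mul hu)
  rw [← Ioo_union_Ici_eq_Ioi one_pos, integrableOn_union]
  constructor
  · refine Integrable.mono' huint (hmeas.mono_set Ioo_subset_Ioi_self) ?_
    filter_upwards [ae_restrict_mem measurableSet_Ioo] with t ht
    have hut := hupos t ht.1
    have h1 : t ^ n ≤ 1 := pow_le_one₀ ht.1.le ht.2.le
    have h2 : exp (-x * t) ≤ 1 := by
      rw [exp_le_one_iff]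
      nlinarith [mul_pos hx ht.1]
    have h0 : 0 ≤ t ^ n := pow_nonneg ht.1.le _
    rw [norm_of_nonneg (by positivity)]
    calc t ^ n * (exp (-x * t) * u t) ≤ 1 * (1 * u t) := by gcongr
      _ = u t := by ring
  · have hsub : Ici (1 : ℝ) ⊆ Ioi 0 := fun t ht => mem_Ioi.2 (zero_lt_one.trans_le ht)
    refine Integrable.mono' (((integrableOn_pow_mul_exp_neg_mul n hx).mono_set hsub).mul_const (u 1))
      (hmeas.mono_set hsub) ?_
    filter_upwards [ae_restrict_mem measurableSet_Ici] with t ht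
    have ht0 : 0 < t := hsub ht
    have hut := hupos t ht0
    rw [norm_of_nonneg (by positivity), mul_assoc]
    gcongr
    exact hudec (by simp) ht0 ht

theorem hasDerivAt_laplaceMoment
    (hint : ∀ n, ∀ x : ℝ, 0 < x → IntegrableOn (fun t => t ^ n * (exp (-x * t) * u t)) (Ioi 0))
    (n : ℕ) (x : ℝ) (hx : 0 < x) :
    HasDerivAt (laplaceMoment u n) (-(laplaceMoment u (n + 1) x)) x := by
  have hs : Ioi (x / 2) ∈ nhds x := Ioi_mem_nhds (by linarith)
  have h := hasDerivAt_integral_of_dominated_loc_of_deriv_le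
    (μ := volume.restrict (Ioi (0 : ℝ)))
    (F := fun y t => t ^ n * (exp (-y * t) * u t))
    (F' := fun y t => -(t ^ (n + 1) * (exp (-y * t) * u t)))
    (bound := fun t => ‖t ^ (n + 1) * (exp (-(x / 2) * t) * u t)‖) hs
    (by filter_upwards [Ioi_mem_nhds hx] with y hy using (hint n y hy).aestronglyMeasurable)
    (hint n x hx) (hint (n + 1) x hx).neg.aestronglyMeasurable
    (by
      filter_upwards [ae_restrict_mem measurableSet_Ioi] with t ht y hy
      rw [norm_neg, norm_mul, norm_mul, norm_mul, norm_mul, norm_of_nonneg (exp_pos _).le,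
        norm_of_nonneg (exp_pos _).le]
      have hty : -y * t ≤ -(x / 2) * t :=
        mul_le_mul_of_nonneg_right (neg_le_neg (le_of_lt hy)) (le_of_lt ht)
      gcongr)
    (hint (n + 1) (x / 2) (by linarith)).norm
    (by
      refine Filter.Eventually.of_forall fun t y _ => ?_
      have h1 : HasDerivAt (fun y : ℝ => -y * t) (-1 * t) y := (hasDerivAt_id y).neg.mul_const t
      refine ((h1.exp.mul_const (u t)).const_mul (t ^ n)).congr_deriv ?_
      ring)
  have h2 := h.2
  rwa [integral_neg] at h2

theorem laplaceMoment_sub_mul_succ_nonneg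
    (hudec : AntitoneOn u (Ioi 0))
    (hint : ∀ n, ∀ x : ℝ, 0 < x → IntegrableOn (fun t => t ^ n * (exp (-x * t) * u t)) (Ioi 0))
    (n : ℕ) (x : ℝ) (hx : 0 < x) :
    0 ≤ (n + 1) * laplaceMoment u n x - x * laplaceMoment u (n + 1) x := by
  obtain ⟨s, hs_def⟩ : ∃ s, s = ((n : ℝ) + 1) / x := ⟨_, rfl⟩
  have hs : 0 < s := by rw [hs_def]; positivity
  have hxs : x * s = n + 1 := by rw [hs_def]; field_simp
  have hexp := fun k => integrableOn_pow_mul_exp_neg_mul k hx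
  have h1 : (n + 1) * laplaceMoment u n x - x * laplaceMoment u (n + 1) x
      = ∫ t in Ioi (0 : ℝ), ((n + 1) * (t ^ n * (exp (-x * t) * u t))
        - x * (t ^ (n + 1) * (exp (-x * t) * u t))) := by
    rw [integral_sub ((hint _ x hx).const_mul _) ((hint _ x hx).const_mul _),
      integral_const_mul, integral_const_mul, laplaceMoment, laplaceMoment]
  have h2 : ∫ t in Ioi (0 : ℝ), ((n + 1) * u s * (t ^ n * exp (-x * t))
        - x * u s * (t ^ (n + 1) * exp (-x * t))) = 0 := by
    rw [integral_sub ((hexp _).const_mul _) ((hexp _).const_mul _),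
      integral_const_mul, integral_const_mul, integral_pow_mul_exp_neg_mul _ hx,
      integral_pow_mul_exp_neg_mul _ hx, Nat.factorial_succ]
    push_cast
    field_simp
    ring
  rw [h1]
  refine h2.ge.trans (setIntegral_mono_on (((hexp _).const_mul _).sub ((hexp _).const_mul _))
    (((hint _ x hx).const_mul _).sub ((hint _ x hx).const_mul _)) measurableSet_Ioi fun t ht => ?_)
  have ht0 : 0 < t := ht
  rw [← sub_nonneg]
  have heq : (n + 1) * (t ^ n * (exp (-x * t) * u t)) - x * (t ^ (n + 1) * (exp (-x * t) * u t))
      - ((n + 1) * u s * (t ^ n * exp (-x * t)) - x * u s * (t ^ (n + 1) * exp (-x * t)))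
      = t ^ n * exp (-x * t) * x * ((s - t) * (u t - u s)) := by
    rw [← hxs]; ring
  rw [heq]
  refine mul_nonneg (by positivity) ?_
  rcases le_total t s with h | h
  · exact mul_nonneg (sub_nonneg.2 h) (sub_nonneg.2 (hudec ht hs h))
  · exact mul_nonneg_of_nonpos_of_nonpos (sub_nonpos.2 h) (sub_nonpos.2 (hudec hs ht h))

end Laplace

theorem of_laplace_of_decreasing_logConvex (α : ℝ) (hα : 0 ≤ α)
    (f u : ℝ → ℝ)
    (hfpos : ∀ x : ℝ, 0 < x → 0 < f x)
    (hupos : ∀ t : ℝ, 0 < t → 0 < u t)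
    (hudec : AntitoneOn u (Set.Ioi 0))
    (hulogconv : ConvexOn ℝ (Set.Ioi 0) (fun t => Real.log (u t)))
    (huint : MeasureTheory.IntegrableOn u (Set.Ioo 0 1))
    (hrep : ∀ x : ℝ, 0 < x →
      x ^ α * f x = ∫ t in Set.Ioi (0 : ℝ), Real.exp (-x * t) * u t) :
    CompletelyMonotonicOn (deriv (fun x => x ^ (α + 1) * f x)) ∧
    CompletelyMonotonicOn (fun x => x ^ (-α) * deriv (fun y => 1 / f y) x) ∧
    CompletelyMonotonicOn (fun x => 1 / (x ^ (α + 1) * f x)) := by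
  have hint := fun n x hx => integrableOn_laplaceMoment hupos hudec huint n (x := x) hx
  have hder := hasDerivAt_laplaceMoment hint
  have hsm := contDiffOn_of_hasDerivAt_neg_succ hder 0
  have hiter := fun n x hx => iteratedDeriv_of_hasDerivAt_neg_succ hder n (x := x) hx
  set M := laplaceMoment u with hM
  have hMpos : ∀ n, ∀ x : ℝ, 0 < x → 0 < M n x := fun n x hx =>
    setIntegral_Ioi_zero_pos (hint n x hx) (s := 0)
      (fun t ht => (mul_pos (pow_pos ht n) (mul_pos (exp_pos _) (hupos t ht))).le)
      fun t ht _ => mul_pos (pow_pos ht n) (mul_pos (exp_pos _) (hupos t ht))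
  have hf : ∀ x : ℝ, 0 < x → x ^ α * f x = M 0 x := fun x hx => by
    simp [hrep x hx, hM, laplaceMoment]
  have hxf : EqOn (fun x => x ^ (α + 1) * f x) (fun x => x * M 0 x) (Ioi 0) := fun x hx => by
    have hx' : 0 < x := hx
    simp only [← hf x hx', rpow_add hx', rpow_one]
    ring
  have hbern : CompletelyMonotonicOn (deriv fun x => x * M 0 x) := by
    refine (completelyMonotonicOn_of_hasDerivAt_neg_succ
      (F := fun n x => (n + 1) * M n x - x * M (n + 1) x) (fun n x hx => ?_)
      (laplaceMoment_sub_mul_succ_nonneg hudec hint)).congr fun x hx => ?_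
    · refine (((hder n x hx).const_mul _).sub
        ((hasDerivAt_id x).mul (hder (n + 1) x hx))).congr_deriv ?_
      push_cast
      simp only [id]
      ring
    · rw [((hasDerivAt_id' x).fun_mul (hder 0 x hx)).deriv]
      push_cast
      ring
  have hrecip : CompletelyMonotonicOn fun x => 1 / (x * M 0 x) :=
    .one_div_of_deriv (contDiffOn_id.mul hsm) (fun x hx => mul_pos hx (hMpos 0 x hx)) hbern
  have hcoeff : ∀ n, ∀ x : ℝ, 0 < x → alternatingTaylorCoeff (M 0) x n = M n x / n.factorial :=
    fun n x hx => by
      rw [alternatingTaylorCoeff, hiter n x hx, ← mul_assoc, ← mul_pow]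
      simp
  have hhirsch : CompletelyMonotonicOn (deriv fun x => 1 / M 0 x) := by
    refine completelyMonotonicOn_deriv_one_div hsm (fun n x hx => ?_) (fun n x hx => ?_)
    · rw [hcoeff n x hx]
      exact div_pos (hMpos n x hx) (by positivity)
    · rw [hcoeff _ x hx, hcoeff _ x hx, hcoeff _ x hx]
      have hconv : ConvexOn ℝ (Ioi 0) fun t => log (exp (-x * t) * u t) := by
        refine (((LinearMap.mul ℝ ℝ (-x)).convexOn (convex_Ioi 0)).add hulogconv).congr
          fun t ht => ?_
        rw [log_mul (exp_ne_zero _) (hupos t ht).ne', log_exp]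
        rfl
      have h := sq_moment_le_of_logConvex (fun t ht => mul_pos (exp_pos (-x * t)) (hupos t ht))
        hconv (fun k => hint k x hx) n
      change (n + 2) * M (n + 1) x ^ 2 ≤ (n + 1) * M n x * M (n + 2) x at h
      rw [Nat.factorial_succ (n + 1), Nat.factorial_succ n, div_pow, div_mul_div_comm,
        div_le_div_iff₀ (by positivity) (by positivity)]
      push_cast
      have := mul_le_mul_of_nonneg_left h
        (show (0 : ℝ) ≤ (n.factorial : ℝ) ^ 2 * (n + 1) by positivity)
      linarith
  refine ⟨hbern.congr (hxf.deriv isOpen_Ioi), ?_, hrecip.congr fun x hx => ?_⟩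
  · refine ((hrecip.const_mul hα).add hhirsch).congr fun x hx => ?_
    have hx' : 0 < x := hx
    have heq : (fun y => 1 / f y) =ᶠ[nhds x] fun y => y ^ α * (1 / M 0 y) := by
      filter_upwards [Ioi_mem_nhds hx'] with y hy
      have h1 := (rpow_pos_of_pos (mem_Ioi.1 hy) α).ne'
      have h2 := (hfpos y hy).ne'
      rw [← hf y hy]
      field_simp
    have hd : DifferentiableAt ℝ (fun y => 1 / M 0 y) x :=
      (differentiableAt_const _).div (hder 0 x hx').differentiableAt (hMpos 0 x hx').ne'
    have h1 := (rpow_pos_of_pos hx' α).ne'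
    have h2 := (hMpos 0 x hx').ne'
    simp only [Pi.add_apply]
    rw [heq.deriv_eq,
      ((hasDerivAt_rpow_const (p := α) (Or.inl hx'.ne')).fun_mul hd.hasDerivAt).deriv,
      rpow_neg hx'.le, rpow_sub_one hx'.ne']
    field_simp
  · simp only [hxf hx]
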